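/- For all n, m ≥ 1, the circular Delannoy number satisfies C(n,m) = n · (D(n,m) − D(n−1,m)). -/

import Mathlib

/-- A Delannoy step: `(1,0)`, `(0,1)` or `(1,1)`. -/
def IsDelannoyStep (p : ℕ × ℕ) : Prop :=
  p = (1, 0) ∨ p = (0, 1) ∨ p = (1, 1)

/-- A based `(n,m)`-loop: a basepoint `v : ZMod n × ZMod m` together with a list of
Delannoy steps whose sum (in `ℕ × ℕ`) is `(n,m)`. -/
def BasedLoop (n m : ℕ) : Type :=
  {b : (ZMod n × ZMod m) × List (ℕ × ℕ) //
    (∀ p ∈ b.2, IsDelannoyStep p) ∧ b.2.sum = (n, m)}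

/-- One-step rotation of based loops: `(v, s₀ :: L) ∼ (v + s̄₀, L ++ [s₀])`,
where `s̄₀` is the image of `s₀` in `ZMod n × ZMod m`. -/
def LoopRot (n m : ℕ) (b₁ b₂ : BasedLoop n m) : Prop :=
  ∃ (v : ZMod n × ZMod m) (s₀ : ℕ × ℕ) (L : List (ℕ × ℕ)),
    b₁.1 = (v, s₀ :: L) ∧
    b₂.1 = (v + ((s₀.1 : ZMod n), (s₀.2 : ZMod m)), L ++ [s₀])

/-- An `(n,m)`-Delannoy loop: an equivalence class of based `(n,m)`-loops under
the equivalence relation generated by rotation. -/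
def DelannoyLoop (n m : ℕ) : Type :=
  Quot (LoopRot n m)

/-- The circular Delannoy number `C(n,m)`: the number of `(n,m)`-Delannoy loops. -/
noncomputable def circularDelannoy (n m : ℕ) : ℕ :=
  Nat.card (DelannoyLoop n m)

/-- Translation of a based loop by `(c,d) ∈ ZMod n × ZMod m`. -/
def BasedLoop.translate {n m : ℕ} (c : ZMod n) (d : ZMod m)
    (b : BasedLoop n m) : BasedLoop n m :=
  ⟨((b.1.1.1 + c, b.1.1.2 + d), b.1.2), b.2⟩
/-- An `(n,m)`-Delannoy path: a list of Delannoy steps whose sum is `(n,m)`. -/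
def DelannoyPath (n m : ℕ) : Type :=
  {s : List (ℕ × ℕ) // (∀ p ∈ s, IsDelannoyStep p) ∧ s.sum = (n, m)}

/-- The Delannoy number `D(n,m)`: the number of `(n,m)`-Delannoy paths. -/
noncomputable def delannoyNumber (n m : ℕ) : ℕ :=
  Nat.card (DelannoyPath n m)

/-- The image of the sum of a list of steps in `ZMod n × ZMod m`. -/
def torusSum (n m : ℕ) (s : List (ℕ × ℕ)) : ZMod n × ZMod m :=
  ((s.sum.1 : ZMod n), (s.sum.2 : ZMod m))

/-- The rotations of `b` that start on the horizontal circle `y = 0` with a step leaving it. -/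
def crossingRotations {n m : ℕ} (b : BasedLoop n m) :
    Set ((ZMod n × ZMod m) × List (ℕ × ℕ)) :=
  {c | ∃ A a B, b.1.2 = A ++ a :: B ∧ a.2 = 1 ∧ (b.1.1 + torusSum n m A).2 = 0 ∧
    c = (b.1.1 + torusSum n m A, a :: B ++ A)}

/-- The paths from `(0,0)` to `(n,m)` whose first step is not horizontal. -/
def RisingPath (n m : ℕ) : Type :=
  {p : DelannoyPath n m // ∃ a L, p.1 = a :: L ∧ a.2 = 1}

theorem IsDelannoyStep.snd_le_one {p : ℕ × ℕ} (h : IsDelannoyStep p) : p.2 ≤ 1 := by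
  rcases h with rfl | rfl | rfl <;> simp

theorem IsDelannoyStep.one_le_add {p : ℕ × ℕ} (h : IsDelannoyStep p) : 1 ≤ p.1 + p.2 := by
  rcases h with rfl | rfl | rfl <;> simp

theorem length_le_of_isDelannoyStep {s : List (ℕ × ℕ)} (hs : ∀ p ∈ s, IsDelannoyStep p) :
    s.length ≤ s.sum.1 + s.sum.2 := by
  induction s with
  | nil => simp
  | cons a s ih =>
    have h₁ := (hs a (by simp)).one_le_add
    have h₂ := ih fun p hp => hs p (by simp [hp])
    simp only [List.length_cons, List.sum_cons, Prod.fst_add, Prod.snd_add]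
    omega

instance DelannoyPath.finite (n m : ℕ) : Finite (DelannoyPath n m) := by
  have : Finite {p : ℕ × ℕ // IsDelannoyStep p} :=
    (Set.toFinite ({(1, 0), (0, 1), (1, 1)} : Set (ℕ × ℕ))).subset fun _ hp => hp
  have hfin := (List.finite_length_le {p : ℕ × ℕ // IsDelannoyStep p} (n + m)).image
    (List.map Subtype.val)
  refine hfin.subset fun s hs => ?_
  obtain ⟨hs, hsum⟩ := hs
  have hlen := length_le_of_isDelannoyStep hs
  lift s to List {p : ℕ × ℕ // IsDelannoyStep p} using hs
  refine ⟨s, ?_, rfl⟩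
  simpa [hsum] using hlen

/-- A list of steps of total height more than `c` has a rising step at height `c`. -/
theorem exists_rising_step {s : List (ℕ × ℕ)} (hs : ∀ p ∈ s, IsDelannoyStep p) {c : ℕ}
    (hc : c < s.sum.2) : ∃ A a B, s = A ++ a :: B ∧ a.2 = 1 ∧ A.sum.2 = c := by
  induction s generalizing c with
  | nil => simp at hc
  | cons x s ih =>
    have hx := (hs x (by simp)).snd_le_one
    have hs' : ∀ p ∈ s, IsDelannoyStep p := fun p hp => hs p (by simp [hp])
    simp only [List.sum_cons, Prod.snd_add] at hc
    by_cases h : x.2 = 1 ∧ c = 0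
    · exact ⟨[], x, s, rfl, h.1, by simp [h.2]⟩
    · obtain ⟨A, a, B, rfl, ha, hA⟩ := ih hs' (c := c - x.2) (by omega)
      refine ⟨x :: A, a, B, rfl, ha, ?_⟩
      simp only [List.sum_cons, Prod.snd_add]
      omega

theorem torusSum_append (n m : ℕ) (s t : List (ℕ × ℕ)) :
    torusSum n m (s ++ t) = torusSum n m s + torusSum n m t := by
  simp [torusSum]

theorem torusSum_cons (n m : ℕ) (a : ℕ × ℕ) (s : List (ℕ × ℕ)) :
    torusSum n m (a :: s) = ((a.1 : ZMod n), (a.2 : ZMod m)) + torusSum n m s := by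
  simp [torusSum]

theorem BasedLoop.torusSum_eq_zero {n m : ℕ} (b : BasedLoop n m) : torusSum n m b.1.2 = 0 := by
  simp [torusSum, b.2.2]

theorem quot_mk_append {n m : ℕ} (v : ZMod n × ZMod m) (A B : List (ℕ × ℕ))
    (h : (∀ p ∈ A ++ B, IsDelannoyStep p) ∧ (A ++ B).sum = (n, m))
    (h' : (∀ p ∈ B ++ A, IsDelannoyStep p) ∧ (B ++ A).sum = (n, m)) :
    Quot.mk (LoopRot n m) ⟨(v, A ++ B), h⟩ =
      Quot.mk (LoopRot n m) ⟨(v + torusSum n m A, B ++ A), h'⟩ := by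
  induction A generalizing v B with
  | nil => exact congrArg (Quot.mk _) (Subtype.ext (by simp [torusSum]))
  | cons a A ih =>
    have hr : (∀ p ∈ A ++ (B ++ [a]), IsDelannoyStep p) ∧ (A ++ (B ++ [a])).sum = (n, m) := by
      refine ⟨fun p hp => h.1 p ?_, ?_⟩
      · simp only [List.mem_append, List.mem_cons, List.not_mem_nil] at hp ⊢
        tauto
      · rw [← h.2]
        simp only [List.sum_append, List.sum_cons, List.sum_nil]
        abel
    have hstep : Quot.mk (LoopRot n m) ⟨(v, a :: A ++ B), h⟩ =
        Quot.mk (LoopRot n m) ⟨(v + ((a.1 : ZMod n), (a.2 : ZMod m)), A ++ (B ++ [a])), hr⟩ :=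
      Quot.sound ⟨v, a, A ++ B, rfl, by simp⟩
    rw [hstep, ih _ _ hr (by simpa using h')]
    congr 3
    · rw [torusSum_cons, add_assoc]
    · simp

theorem prefix_eq_of_crossing {m : ℕ} {A A' B B' : List (ℕ × ℕ)} {a a' : ℕ × ℕ}
    (h : A ++ a :: B = A' ++ a' :: B') (ha : a.2 = 1) (ha' : a'.2 = 1)
    (hm : (A ++ a :: B).sum.2 = m) (hA : (A.sum.2 : ZMod m) = (A'.sum.2 : ZMod m)) :
    A = A' := by
  wlog hle : A.length ≤ A'.length generalizing A A' B B' a a'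
  · exact (this h.symm ha' ha (h ▸ hm) hA.symm (by omega)).symm
  obtain ⟨C, rfl⟩ : A <+: A' := List.prefix_of_prefix_length_le (List.prefix_append A (a :: B))
    (h ▸ List.prefix_append A' (a' :: B')) hle
  rw [List.append_assoc, List.append_cancel_left_eq] at h
  cases C with
  | nil => simp
  | cons c C =>
    simp only [List.cons_append, List.cons.injEq] at h
    obtain ⟨rfl, rfl⟩ := h
    rw [ZMod.natCast_eq_natCast_iff] at hA
    simp only [List.sum_append, List.sum_cons, Prod.snd_add] at hm hA
    have hdvd := (Nat.modEq_iff_dvd' (by omega)).mp hA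
    have := Nat.le_of_dvd (by omega) hdvd
    omega

theorem crossingRotations_subsingleton {n m : ℕ} (b : BasedLoop n m) :
    (crossingRotations b).Subsingleton := by
  rintro _ ⟨A, a, B, hs, ha, hA, rfl⟩ _ ⟨A', a', B', hs', ha', hA', rfl⟩
  have hAA : A = A' := by
    refine prefix_eq_of_crossing (m := m) (hs.symm.trans hs') ha ha' ?_ ?_
    · rw [← hs, b.2.2]
    · exact add_left_cancel (hA.trans hA'.symm)
  subst hAA
  rw [hs, List.append_cancel_left_eq] at hs'
  rw [hs']

theorem crossingRotations_nonempty {n m : ℕ} (hm : 1 ≤ m) (b : BasedLoop n m) :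
    (crossingRotations b).Nonempty := by
  have : NeZero m := ⟨by omega⟩
  obtain ⟨A, a, B, hs, ha, hA⟩ := exists_rising_step b.2.1 (c := (-b.1.1.2).val)
    (by rw [b.2.2]; exact ZMod.val_lt _)
  exact ⟨_, A, a, B, hs, ha, by simp [torusSum, hA], rfl⟩

theorem crossingRotations_subset {n m : ℕ} {b b' : BasedLoop n m} (h : LoopRot n m b b') :
    crossingRotations b ⊆ crossingRotations b' := by
  obtain ⟨v, x, L, hb, hb'⟩ := h
  have hzero := b.torusSum_eq_zero
  rintro _ ⟨A, a, B, hs, ha, hA, rfl⟩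
  simp only [hb] at hs hA hzero ⊢
  rw [torusSum_cons] at hzero
  cases A with
  | nil =>
    obtain ⟨rfl, rfl⟩ := List.cons.inj hs
    have hv : v + torusSum n m [] = v + ((x.1 : ZMod n), (x.2 : ZMod m)) + torusSum n m L := by
      rw [add_assoc, hzero]
      simp [torusSum]
    rw [hv] at hA ⊢
    exact ⟨L, x, [], by rw [hb'], ha, by rwa [hb'], by rw [hb']; simp⟩
  | cons y A =>
    obtain ⟨rfl, rfl⟩ := List.cons.inj hs
    rw [torusSum_cons, ← add_assoc] at hA ⊢
    exact ⟨A, a, B ++ [x], by rw [hb']; simp, ha, by rwa [hb'], by rw [hb']; simp⟩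

theorem crossingRotations_eq {n m : ℕ} (hm : 1 ≤ m) {b b' : BasedLoop n m}
    (h : LoopRot n m b b') : crossingRotations b = crossingRotations b' := by
  obtain ⟨c, hc⟩ := crossingRotations_nonempty hm b
  have hsub := crossingRotations_subset h
  exact hsub.antisymm fun d hd => crossingRotations_subsingleton b' hd (hsub hc) ▸ hc

/-- The loop traced by a rising path based at `(x, 0)`. -/
def RisingPath.toLoop {n m : ℕ} (q : ZMod n × RisingPath n m) : DelannoyLoop n m :=
  Quot.mk _ ⟨((q.1, 0), q.2.1.1), q.2.1.2⟩

theorem RisingPath.mem_crossingRotations {n m : ℕ} (q : ZMod n × RisingPath n m) :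
    ((q.1, 0), q.2.1.1) ∈ crossingRotations (⟨((q.1, 0), q.2.1.1), q.2.1.2⟩ : BasedLoop n m) := by
  obtain ⟨a, L, hs, ha⟩ := q.2.2
  exact ⟨[], a, L, hs, ha, by simp [torusSum], by simp [torusSum, hs]⟩

theorem RisingPath.toLoop_bijective {n m : ℕ} (hm : 1 ≤ m) :
    Function.Bijective (RisingPath.toLoop (n := n) (m := m)) := by
  constructor
  · intro q q' h
    have heq := congrArg (Quot.lift crossingRotations fun _ _ => crossingRotations_eq hm) h
    have hpair := crossingRotations_subsingleton _
      (heq.le (RisingPath.mem_crossingRotations q)) (RisingPath.mem_crossingRotations q')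
    simp only [Prod.mk.injEq, and_true] at hpair
    exact Prod.ext hpair.1 (Subtype.ext (Subtype.ext hpair.2))
  · rintro ⟨⟨⟨v, s⟩, hs⟩⟩
    obtain ⟨_, A, a, B, rfl, ha, hA, rfl⟩ := crossingRotations_nonempty hm ⟨(v, s), hs⟩
    have hs' : (∀ p ∈ a :: B ++ A, IsDelannoyStep p) ∧ (a :: B ++ A).sum = (n, m) := by
      refine ⟨fun p hp => hs.1 p (List.mem_append.mpr (List.mem_append.mp hp).symm), ?_⟩
      rw [← hs.2]
      simp only [List.sum_append]
      abel
    refine ⟨((v + torusSum n m A).1, ⟨⟨_, hs'⟩, a, B ++ A, rfl, ha⟩), ?_⟩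
    refine Eq.trans ?_ (quot_mk_append v A (a :: B) hs hs').symm
    exact congrArg (Quot.mk _) (Subtype.ext (Prod.ext (Prod.ext rfl hA.symm) rfl))

/-- Prepending a horizontal step. -/
def DelannoyPath.consHorizontal {n m : ℕ} (hn : 1 ≤ n) (p : DelannoyPath (n - 1) m) :
    {p : DelannoyPath n m // ¬ ∃ a L, p.1 = a :: L ∧ a.2 = 1} :=
  ⟨⟨(1, 0) :: p.1, by
    refine ⟨?_, ?_⟩
    · simpa [IsDelannoyStep] using fun a b => p.2.1 (a, b)
    · rw [List.sum_cons, p.2.2]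
      simp
      omega⟩, by
    rintro ⟨a, L, h, ha⟩
    obtain ⟨rfl, -⟩ := List.cons.inj h
    simp at ha⟩

theorem DelannoyPath.consHorizontal_bijective {n m : ℕ} (hn : 1 ≤ n) (hm : 1 ≤ m) :
    Function.Bijective (DelannoyPath.consHorizontal (m := m) hn) := by
  constructor
  · intro p q h
    exact Subtype.ext (List.cons.inj (congrArg (fun r => r.1.1) h)).2
  · rintro ⟨⟨s, hs, hsum⟩, h⟩
    cases s with
    | nil =>
      simp only [List.sum_nil, Prod.ext_iff, Prod.snd_zero] at hsum
      omega
    | cons a L =>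
      obtain rfl : a = (1, 0) := by
        rcases hs a (by simp) with rfl | rfl | rfl
        · rfl
        · exact absurd ⟨_, L, rfl, rfl⟩ h
        · exact absurd ⟨_, L, rfl, rfl⟩ h
      refine ⟨⟨L, fun p hp => hs p (by simp [hp]), ?_⟩, rfl⟩
      simp only [List.sum_cons, Prod.ext_iff, Prod.fst_add, Prod.snd_add] at hsum ⊢
      omega

theorem card_risingPath_add {n m : ℕ} (hn : 1 ≤ n) (hm : 1 ≤ m) :
    Nat.card (RisingPath n m) + delannoyNumber (n - 1) m = delannoyNumber n m := by
  classical
  have : Finite (RisingPath n m) := Subtype.finite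
  unfold delannoyNumber
  rw [Nat.card_eq_of_bijective _ (DelannoyPath.consHorizontal_bijective hn hm), ← Nat.card_sum]
  exact Nat.card_congr (Equiv.sumCompl _)

/-- For `n, m ≥ 1`, `C(n,m) = n · (D(n,m) − D(n−1,m))` (as integers). -/
theorem circularDelannoy_eq_mul_sub (n m : ℕ) (hn : 1 ≤ n) (hm : 1 ≤ m) :
    (circularDelannoy n m : ℤ) =
      n * ((delannoyNumber n m : ℤ) - delannoyNumber (n - 1) m) := by
  have hC : circularDelannoy n m = n * Nat.card (RisingPath n m) := by
    rw [circularDelannoy, ← Nat.card_eq_of_bijective _ (RisingPath.toLoop_bijective (n := n) hm),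
      Nat.card_prod, Nat.card_zmod]
  rw [hC, ← card_risingPath_add hn hm]
  push_cast
  ring
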